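/- Let q be a prime power. For every n ≥ 1, c_A(n,q) − c_A(n−1,q) = (s_A(n,q) − s_A(n−1,q))/q^n; equivalently, the generating function identity (1 − u)·Σ_n c_A(n,q)u^n = (1 − u/q)·Σ_n s_A(n,q)(u/q)^n holds coefficientwise. -/

import Mathlib

open Matrix

/-- Membership in the affine group `A(n,q)`: invertible `(n+1) × (n+1)` matrices with
`x_{11} = 1` and `x_{j1} = 0` for `j ≥ 2` (indices starting at `0` in Lean). -/
def IsAff {F : Type} [Field F] {n : ℕ} (x : GL (Fin (n + 1)) F) : Prop :=
  x.val 0 0 = 1 ∧ ∀ j : Fin (n + 1), j ≠ 0 → x.val j 0 = 0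

/-- `s_A(n,q)`: the proportion of separable elements (squarefree characteristic polynomial)
of the affine group `A(n,q)`. -/
noncomputable def sA (F : Type) [Field F] [Fintype F] (n : ℕ) : ℝ :=
  (Nat.card {x : GL (Fin (n + 1)) F // IsAff x ∧ Squarefree x.val.charpoly} : ℝ) /
    (Nat.card {x : GL (Fin (n + 1)) F // IsAff x} : ℝ)

/-- `c_A(n,q)`: the proportion of cyclic elements (characteristic polynomial equal to the
minimal polynomial) of the affine group `A(n,q)`. -/
noncomputable def cA (F : Type) [Field F] [Fintype F] (n : ℕ) : ℝ :=
  (Nat.card {x : GL (Fin (n + 1)) F //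
      IsAff x ∧ x.val.charpoly = minpoly F x.val} : ℝ) /
    (Nat.card {x : GL (Fin (n + 1)) F // IsAff x} : ℝ)

section PolynomialCounting

open Polynomial Finset
open scoped Classical

variable {F : Type} [Field F] [Fintype F]

variable (F) in
/-- The polynomials of degree less than `N` over a finite field. -/
noncomputable def polysLT (N : ℕ) : Finset F[X] :=
  (Finset.univ : Finset (Fin N → F)).map
    ((degreeLTEquiv F N).symm.toEquiv.toEmbedding.trans (Function.Embedding.subtype _))

lemma mem_polysLT {N : ℕ} {p : F[X]} : p ∈ polysLT F N ↔ p.degree < N := by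
  simp only [polysLT, mem_map, mem_univ, true_and, Function.Embedding.trans_apply,
    Equiv.coe_toEmbedding, Function.Embedding.subtype_apply, ← mem_degreeLT]
  constructor
  · rintro ⟨a, rfl⟩
    exact Subtype.prop _
  · intro hp
    exact ⟨degreeLTEquiv F N ⟨p, hp⟩, by simp⟩

lemma card_polysLT (N : ℕ) : (polysLT F N).card = Fintype.card F ^ N := by
  simp [polysLT]

/-- The number of units `u` of `F[X]/(h)` with `u(1) = 1`, counted on reduced representatives. -/
noncomputable def unitCount (h : F[X]) : ℕ :=
  ((polysLT F h.natDegree).filter fun p => IsCoprime p h ∧ p.eval 1 = 1).card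

lemma degree_lt_natDegree_iff {h : F[X]} (hh : h.Monic) {p : F[X]} :
    p ∈ polysLT F h.natDegree ↔ p.degree < h.degree := by
  rw [mem_polysLT, degree_eq_natDegree hh.ne_zero]

lemma unitCount_pos {h : F[X]} (hh : h.Monic) (h1 : h.eval 1 = 0) : 0 < unitCount h := by
  refine Finset.card_pos.2 ⟨1, ?_⟩
  have : 0 < h.degree := degree_pos_of_root hh.ne_zero h1
  simp [degree_lt_natDegree_iff hh, isCoprime_one_left, this]

/-- The unique `k` modulo `p` with `p ∣ r + h * k`, when `p` and `h` are coprime. -/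
lemma card_filter_dvd_add_mul {h p : F[X]} (hp : p.Monic) (hc : IsCoprime p h) (r : F[X]) :
    ((polysLT F p.natDegree).filter fun k => p ∣ r + h * k).card = 1 := by
  obtain ⟨a, b, hab⟩ := hc
  rw [Finset.card_eq_one]
  refine ⟨(-(b * r)) %ₘ p, ?_⟩
  ext k
  simp only [mem_filter, degree_lt_natDegree_iff hp, mem_singleton]
  constructor
  · rintro ⟨hk, c, hc⟩
    refine (div_modByMonic_unique (-(a * k + b * c)) k hp ⟨?_, hk⟩).2.symm
    linear_combination b * hc - k * hab
  · rintro rfl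
    refine ⟨degree_modByMonic_lt _ hp, ?_⟩
    have := modByMonic_add_div (-(b * r)) p
    refine ⟨a * r - h * (-(b * r) /ₘ p), ?_⟩
    linear_combination h * this - r * hab

/-- Division with remainder by a monic `h` as a bijection. -/
lemma card_filter_mul {h p : F[X]} (hh : h.Monic) (hp : p.Monic) (P : F[X] → Prop)
    [DecidablePred P] :
    ((polysLT F (p * h).natDegree).filter P).card =
      ∑ r ∈ polysLT F h.natDegree,
        ((polysLT F p.natDegree).filter fun k => P (r + h * k)).card := by
  rw [← Finset.card_sigma]
  refine Finset.card_bij' (fun f _ => ⟨f %ₘ h, f /ₘ h⟩)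
    (fun x _ => x.1 + h * x.2) ?_ ?_ ?_ ?_
  · intro f hf
    simp only [mem_filter, degree_lt_natDegree_iff (hp.mul hh), mem_sigma,
      degree_lt_natDegree_iff hp, degree_lt_natDegree_iff hh, modByMonic_add_div] at hf ⊢
    refine ⟨degree_modByMonic_lt _ hh, ?_, hf.2⟩
    by_cases hlt : f.degree < h.degree
    · rw [(divByMonic_eq_zero_iff hh).2 hlt]
      simpa using bot_lt_iff_ne_bot.2 (by simpa using hp.ne_zero)
    · have h2 := degree_add_divByMonic hh (not_lt.1 hlt)
      have h3 := hf.1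
      rw [← h2, degree_mul, add_comm p.degree] at h3
      exact lt_of_add_lt_add_left h3
  · rintro ⟨r, k⟩ hx
    simp only [mem_filter, degree_lt_natDegree_iff (hp.mul hh), mem_sigma,
      degree_lt_natDegree_iff hp, degree_lt_natDegree_iff hh] at hx ⊢
    refine ⟨?_, hx.2.2⟩
    refine (degree_add_le _ _).trans_lt (max_lt ?_ ?_)
    · refine hx.1.trans_le ?_
      rw [mul_comm]; exact degree_le_mul_left _ hp.ne_zero
    · rw [mul_comm p, degree_mul, degree_mul]
      have : h.degree ≠ ⊥ := by simpa using hh.ne_zero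
      exact WithBot.add_lt_add_left this hx.2.1
  · intro f _
    exact modByMonic_add_div f h
  · rintro ⟨r, k⟩ hx
    simp only [mem_sigma, degree_lt_natDegree_iff hh] at hx
    have := div_modByMonic_unique k r hh ⟨rfl, hx.1⟩
    simp [this.1, this.2]

lemma isCoprime_irreducible_mul_iff {K : Type*} [Field K] {p h f : K[X]} (hp : Irreducible p) :
    IsCoprime f (p * h) ↔ ¬ p ∣ f ∧ IsCoprime f h := by
  rw [IsCoprime.mul_right_iff, isCoprime_comm, hp.coprime_iff_not_dvd]

lemma unitCount_mul {h p : F[X]} (hh : h.Monic) (h1 : h.eval 1 = 0) (hp : p.Monic)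
    (hpi : Irreducible p) :
    unitCount (p * h) = unitCount h *
      (Fintype.card F ^ p.natDegree - if p ∣ h then 0 else 1) := by
  rw [unitCount, card_filter_mul hh hp, unitCount, Finset.card_filter, Finset.sum_mul]
  refine Finset.sum_congr rfl fun r hr => ?_
  simp only [isCoprime_irreducible_mul_iff hpi, IsCoprime.add_mul_left_left_iff, eval_add,
    eval_mul, h1, zero_mul, add_zero]
  by_cases hr' : IsCoprime r h ∧ r.eval 1 = 1
  · rw [if_pos hr', one_mul]
    simp only [hr'.1, hr'.2, and_true]
    rw [← card_polysLT, ← Finset.card_filter_add_card_filter_not (s := polysLT F p.natDegree)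
      (fun k => p ∣ r + h * k)]
    have : ((polysLT F p.natDegree).filter fun k => p ∣ r + h * k).card =
        if p ∣ h then 0 else 1 := by
      split_ifs with hd
      · rw [Finset.card_eq_zero, Finset.filter_eq_empty_iff]
        intro k _ hk
        have : p ∣ r := (dvd_add_left (hd.mul_right k)).mp hk
        exact hpi.not_isUnit (hr'.1.isUnit_of_dvd' this hd)
      · exact card_filter_dvd_add_mul hp ((hpi.coprime_iff_not_dvd).2 hd) r
    omega
  · rw [if_neg hr', zero_mul, Finset.card_eq_zero, Finset.filter_eq_empty_iff]
    tauto

variable (F) in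
/-- The monic polynomials of degree `n` over a finite field that do not vanish at `0`. -/
noncomputable def monicUnits (n : ℕ) : Finset F[X] :=
  (polysLT F (n + 1)).filter fun f => f.Monic ∧ f.natDegree = n ∧ f.eval 0 ≠ 0

lemma mem_monicUnits {n : ℕ} {f : F[X]} :
    f ∈ monicUnits F n ↔ f.Monic ∧ f.natDegree = n ∧ f.eval 0 ≠ 0 := by
  simp only [monicUnits, mem_filter, mem_polysLT, and_iff_right_iff_imp]
  rintro ⟨hf, rfl, -⟩
  rw [degree_eq_natDegree hf.ne_zero]
  exact_mod_cast Nat.lt_succ_self _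

lemma card_monic (n : ℕ) :
    ((polysLT F (n + 1)).filter fun f => f.Monic ∧ f.natDegree = n).card =
      Fintype.card F ^ n := by
  rw [← card_polysLT]
  symm
  refine Finset.card_bij (fun r _ => X ^ n + r) ?_ ?_ ?_
  · intro r hr
    rw [mem_polysLT] at hr
    have hd : (X ^ n + r).degree = (n : WithBot ℕ) := by
      rw [degree_add_eq_left_of_degree_lt (by simpa using hr), degree_X_pow]
    simp only [mem_filter, mem_polysLT, hd]
    exact ⟨by exact_mod_cast Nat.lt_succ_self n, monic_X_pow_add hr,
      natDegree_eq_of_degree_eq_some hd⟩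
  · intro r _ s _ h
    exact add_left_cancel h
  · intro f hf
    simp only [mem_filter] at hf
    obtain ⟨-, hm, rfl⟩ := hf
    refine ⟨f - X ^ f.natDegree, ?_, by ring⟩
    rw [mem_polysLT, ← degree_eq_natDegree hm.ne_zero]
    exact degree_sub_lt_left (by simp [degree_eq_natDegree hm.ne_zero]) hm.ne_zero
      (by simp [hm.leadingCoeff])

lemma card_monicUnits_zero : (monicUnits F 0).card = 1 := by
  rw [Finset.card_eq_one]
  refine ⟨1, ?_⟩
  ext f
  rw [mem_monicUnits, mem_singleton]
  constructor
  · rintro ⟨hm, h0, -⟩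
    exact hm.natDegree_eq_zero.1 h0
  · rintro rfl
    simp

lemma card_monicUnits_succ (n : ℕ) :
    (monicUnits F (n + 1)).card + Fintype.card F ^ n = Fintype.card F ^ (n + 1) := by
  rw [← card_monic n, ← card_monic (n + 1),
    ← Finset.card_filter_add_card_filter_not (s := (polysLT F (n + 1 + 1)).filter _)
      (fun f => f.eval 0 ≠ 0)]
  congr 1
  · rw [Finset.filter_filter, monicUnits]
    simp only [and_assoc]
  · refine Finset.card_bij (fun r _ => X * r) ?_ ?_ ?_
    · intro r hr
      simp only [mem_filter, mem_polysLT] at hr ⊢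
      obtain ⟨-, hm, rfl⟩ := hr
      have hXr : (X * r).Monic := monic_X.mul hm
      have hd : (X * r).natDegree = r.natDegree + 1 := by
        rw [natDegree_X_mul hm.ne_zero]
      refine ⟨⟨?_, hXr, hd⟩, by simp⟩
      rw [degree_eq_natDegree hXr.ne_zero, hd]
      exact_mod_cast Nat.lt_succ_self _
    · intro r _ s _ h
      exact mul_left_cancel₀ X_ne_zero h
    · intro f hf
      simp only [mem_filter, mem_polysLT, not_not] at hf
      obtain ⟨⟨-, hm, hn⟩, h0⟩ := hf
      obtain ⟨g, rfl⟩ := (X_dvd_iff (f := f)).2 (by rwa [coeff_zero_eq_eval_zero])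
      have hg : g.Monic := monic_X.of_mul_monic_left hm
      rw [natDegree_X_mul hg.ne_zero] at hn
      refine ⟨g, ?_, rfl⟩
      simp only [mem_filter, mem_polysLT]
      refine ⟨?_, hg, by omega⟩
      rw [degree_eq_natDegree hg.ne_zero]
      exact_mod_cast (by omega : g.natDegree < n + 1)

/-- The monic divisors of a nonzero polynomial over a finite field. -/
noncomputable def monicDivisors (f : F[X]) : Finset F[X] :=
  (polysLT F (f.natDegree + 1)).filter fun g => g.Monic ∧ g ∣ f

lemma mem_monicDivisors {f : F[X]} (hf : f ≠ 0) {g : F[X]} :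
    g ∈ monicDivisors f ↔ g.Monic ∧ g ∣ f := by
  simp only [monicDivisors, mem_filter, mem_polysLT, and_iff_right_iff_imp]
  rintro ⟨hg, hd⟩
  rw [degree_eq_natDegree hg.ne_zero]
  exact_mod_cast Nat.lt_succ_iff.2 (natDegree_le_of_dvd hd hf)

/-- A squarefree divisor of `p * h` with `p ∣ h` already divides `h`. -/
lemma squarefree_dvd_of_dvd_mul {K : Type*} [Field K] {p h g : K[X]} (hp : Irreducible p)
    (hph : p ∣ h) (hg : Squarefree g) (hd : g ∣ p * h) : g ∣ h := by
  by_cases hpg : p ∣ g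
  · obtain ⟨k, rfl⟩ := hpg
    have hpk : IsCoprime p k := (squarefree_mul_iff.1 hg).1.isCoprime
    exact hpk.mul_dvd hph ((mul_dvd_mul_iff_left hp.ne_zero).1 hd)
  · exact ((hp.coprime_iff_not_dvd).2 hpg).symm.dvd_of_dvd_mul_left hd

/-- The analogue of `n / φ(n) = ∑_{d ∣ n} μ(d)² / φ(d)` for the weights `1 / unitCount`. -/
lemma sum_inv_unitCount {f : F[X]} (hf : f.Monic) :
    ∑ g ∈ (monicDivisors f).filter (fun g => Squarefree ((X - C 1) * g)),
      (unitCount ((X - C 1) * g) : ℝ)⁻¹ =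
      (Fintype.card F : ℝ) ^ f.natDegree * (unitCount ((X - C 1) * f) : ℝ)⁻¹ := by
  induction hn : f.natDegree using Nat.strong_induction_on generalizing f with
  | _ n ih =>
  subst hn
  by_cases hu : f = 1
  · subst hu
    have : (monicDivisors (1 : F[X])).filter (fun g => Squarefree ((X - C 1) * g)) = {1} := by
      ext g
      simp only [mem_filter, mem_monicDivisors one_ne_zero, mem_singleton]
      constructor
      · rintro ⟨⟨hg, hd⟩, -⟩
        exact hg.eq_one_of_isUnit (isUnit_of_dvd_one hd)
      · rintro rfl
        simpa using (irreducible_X_sub_C (1 : F)).squarefree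
    rw [this]
    simp
  obtain ⟨p, hp, hpi, f₀, rfl⟩ := exists_monic_irreducible_factor f (by rwa [hf.isUnit_iff])
  have hf₀ : f₀.Monic := hp.of_mul_monic_left hf
  have hp0 : 0 < p.natDegree := hpi.natDegree_pos
  have hdeg : (p * f₀).natDegree = p.natDegree + f₀.natDegree := hp.natDegree_mul hf₀
  have IH := ih f₀.natDegree (by omega) hf₀ rfl
  have hmon : ∀ {g : F[X]}, g.Monic → ((X - C 1) * g).Monic := fun hg =>
    (monic_X_sub_C 1).mul hg
  have hev : ∀ g : F[X], ((X - C 1) * g).eval 1 = 0 := fun g => by simp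
  have hcount : ∀ {g : F[X]}, g.Monic → unitCount ((X - C 1) * (p * g)) =
      unitCount ((X - C 1) * g) *
        (Fintype.card F ^ p.natDegree - if p ∣ (X - C 1) * g then 0 else 1) := fun hg => by
    rw [mul_left_comm, unitCount_mul (hmon hg) (hev _) hp hpi]
  have hq : 1 < Fintype.card F ^ p.natDegree := Nat.one_lt_pow hp0.ne' Fintype.one_lt_card
  have hq' : (1 : ℝ) < (Fintype.card F : ℝ) ^ p.natDegree := by exact_mod_cast hq
  rw [hcount hf₀, hdeg, pow_add]
  by_cases hd : p ∣ (X - C 1) * f₀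
  · have hset : (monicDivisors (p * f₀)).filter (fun g => Squarefree ((X - C 1) * g)) =
        (monicDivisors f₀).filter (fun g => Squarefree ((X - C 1) * g)) := by
      ext g
      simp only [mem_filter, mem_monicDivisors hf.ne_zero, mem_monicDivisors hf₀.ne_zero]
      refine and_congr_left fun hs => and_congr_right fun _ =>
        ⟨fun h => ?_, fun h => h.mul_left _⟩
      rw [← mul_dvd_mul_iff_left (X_sub_C_ne_zero (1 : F))]
      refine squarefree_dvd_of_dvd_mul hpi hd hs ?_
      rw [mul_left_comm]
      exact mul_dvd_mul_left _ h
    rw [hset, IH, if_pos hd]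
    push_cast
    rw [Nat.sub_zero]
    push_cast
    field_simp
  · have hset : (monicDivisors (p * f₀)).filter (fun g => Squarefree ((X - C 1) * g)) =
        (monicDivisors f₀).filter (fun g => Squarefree ((X - C 1) * g)) ∪
        ((monicDivisors f₀).filter (fun g => Squarefree ((X - C 1) * g))).image (p * ·) := by
      ext g
      simp only [mem_union, mem_image, mem_filter, mem_monicDivisors hf.ne_zero,
        mem_monicDivisors hf₀.ne_zero]
      constructor
      · rintro ⟨⟨hg, hgd⟩, hs⟩
        by_cases hpg : p ∣ g
        · obtain ⟨k, rfl⟩ := hpg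
          refine Or.inr ⟨k, ⟨⟨hp.of_mul_monic_left hg, ?_⟩, ?_⟩, rfl⟩
          · exact (mul_dvd_mul_iff_left hpi.ne_zero).1 hgd
          · exact hs.squarefree_of_dvd (mul_dvd_mul_left _ (dvd_mul_left _ _))
        · exact Or.inl
            ⟨⟨hg, ((hpi.coprime_iff_not_dvd).2 hpg).symm.dvd_of_dvd_mul_left hgd⟩, hs⟩
      · rintro (⟨⟨hg, hgd⟩, hs⟩ | ⟨k, ⟨⟨hk, hkd⟩, hs⟩, rfl⟩)
        · exact ⟨⟨hg, hgd.mul_left _⟩, hs⟩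
        · refine ⟨⟨hp.mul hk, mul_dvd_mul_left _ hkd⟩, ?_⟩
          rw [mul_left_comm, squarefree_mul_iff]
          refine ⟨((hpi.coprime_iff_not_dvd).2 fun h => hd (h.trans ?_)).isRelPrime,
            hpi.squarefree, hs⟩
          exact mul_dvd_mul_left _ hkd
    rw [hset, Finset.sum_union, Finset.sum_image, if_neg hd]
    · have hterm : ∀ g ∈ (monicDivisors f₀).filter (fun g => Squarefree ((X - C 1) * g)),
          (unitCount ((X - C 1) * (p * g)) : ℝ)⁻¹ =
          (unitCount ((X - C 1) * g) : ℝ)⁻¹ *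
            ((Fintype.card F : ℝ) ^ p.natDegree - 1)⁻¹ := by
        intro g hg
        simp only [mem_filter, mem_monicDivisors hf₀.ne_zero] at hg
        rw [hcount hg.1.1, if_neg fun h => hd (h.trans (mul_dvd_mul_left _ hg.1.2))]
        push_cast [Nat.cast_sub hq.le]
        rw [mul_inv]
      rw [Finset.sum_congr rfl hterm, ← Finset.sum_mul, IH]
      push_cast [Nat.cast_sub hq.le]
      have : (Fintype.card F : ℝ) ^ p.natDegree - 1 ≠ 0 := by linarith
      rw [mul_inv]
      field_simp
      ring
    · intro a _ b _ h
      exact mul_left_cancel₀ hpi.ne_zero h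
    · rw [Finset.disjoint_left]
      intro g hg hg'
      simp only [mem_image, mem_filter, mem_monicDivisors hf₀.ne_zero] at hg hg'
      obtain ⟨k, -, rfl⟩ := hg'
      exact hd (((dvd_mul_right _ _).trans hg.1.2).mul_left _)

variable (F) in
/-- The polynomial form of `c_A(n,q)`. -/
noncomputable def cyclicSum (n : ℕ) : ℝ :=
  ∑ f ∈ monicUnits F n, (unitCount ((X - C 1) * f) : ℝ)⁻¹

variable (F) in
/-- The polynomial form of `s_A(n,q)`. -/
noncomputable def separableSum (n : ℕ) : ℝ :=
  ∑ f ∈ (monicUnits F n).filter (fun f => Squarefree ((X - C 1) * f)),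
    (unitCount ((X - C 1) * f) : ℝ)⁻¹

lemma pow_mul_cyclicSum (n : ℕ) :
    (Fintype.card F : ℝ) ^ n * cyclicSum F n =
      ∑ m ∈ range (n + 1), separableSum F m * (monicUnits F (n - m)).card := by
  have h1 : (Fintype.card F : ℝ) ^ n * cyclicSum F n = ∑ f ∈ monicUnits F n,
      ∑ g ∈ (monicDivisors f).filter (fun g => Squarefree ((X - C 1) * g)),
        (unitCount ((X - C 1) * g) : ℝ)⁻¹ := by
    rw [cyclicSum, Finset.mul_sum]
    refine Finset.sum_congr rfl fun f hf => ?_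
    rw [mem_monicUnits] at hf
    rw [sum_inv_unitCount hf.1, hf.2.1]
  have h2 : ∀ m, separableSum F m * (monicUnits F (n - m)).card =
      ∑ x ∈ ((monicUnits F m).filter (fun f => Squarefree ((X - C 1) * f))) ×ˢ
        monicUnits F (n - m), (unitCount ((X - C 1) * x.1) : ℝ)⁻¹ := fun m => by
    rw [Finset.sum_product, separableSum, Finset.sum_mul]
    refine Finset.sum_congr rfl fun f _ => ?_
    simp only [Finset.sum_const, nsmul_eq_mul, mul_comm]
  simp only [h1, h2]
  rw [Finset.sum_sigma', Finset.sum_sigma']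
  refine Finset.sum_bij' (fun x _ => ⟨x.2.natDegree, x.2, x.1 /ₘ x.2⟩)
    (fun y _ => ⟨y.2.1 * y.2.2, y.2.1⟩) ?_ ?_ ?_ ?_ ?_
  · rintro ⟨f, g⟩ hx
    simp only [mem_sigma, mem_filter, mem_monicUnits] at hx
    obtain ⟨⟨hf, hn, h0⟩, hg, hs⟩ := hx
    obtain ⟨hgm, k, rfl⟩ := (mem_monicDivisors hf.ne_zero).1 hg
    have hk : k.Monic := hgm.of_mul_monic_left hf
    have hdiv : (g * k) /ₘ g = k := mul_divByMonic_cancel_left k hgm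
    rw [hgm.natDegree_mul hk] at hn
    rw [eval_mul, mul_ne_zero_iff] at h0
    simp only [mem_sigma, mem_range, mem_product, mem_filter, mem_monicUnits, hdiv]
    refine ⟨by omega, ⟨⟨hgm, trivial, h0.1⟩, hs⟩, hk, by omega, h0.2⟩
  · rintro ⟨m, g, k⟩ hy
    simp only [mem_sigma, mem_range, mem_product, mem_filter, mem_monicUnits] at hy
    obtain ⟨hm, ⟨⟨hg, rfl, hg0⟩, hs⟩, hk, hkd, hk0⟩ := hy
    simp only [mem_sigma, mem_filter, mem_monicUnits, mem_monicDivisors (hg.mul hk).ne_zero]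
    refine ⟨⟨hg.mul hk, ?_, ?_⟩, ⟨hg, dvd_mul_right _ _⟩, hs⟩
    · rw [hg.natDegree_mul hk]; omega
    · rw [eval_mul]; exact mul_ne_zero hg0 hk0
  · rintro ⟨f, g⟩ hx
    simp only [mem_sigma, mem_filter, mem_monicUnits] at hx
    obtain ⟨⟨hf, hn, h0⟩, hg, hs⟩ := hx
    obtain ⟨hgm, k, rfl⟩ := (mem_monicDivisors hf.ne_zero).1 hg
    simp [mul_divByMonic_cancel_left k hgm]
  · rintro ⟨m, g, k⟩ hy
    simp only [mem_sigma, mem_range, mem_product, mem_filter, mem_monicUnits] at hy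
    obtain ⟨hm, ⟨⟨hg, rfl, hg0⟩, hs⟩, hk, hkd, hk0⟩ := hy
    simp [mul_divByMonic_cancel_left k hg]
  · rintro ⟨f, g⟩ _
    rfl

lemma cyclicSum_sub (n : ℕ) :
    cyclicSum F (n + 1) - cyclicSum F n =
      (separableSum F (n + 1) - separableSum F n) / (Fintype.card F : ℝ) ^ (n + 1) := by
  have hq : (Fintype.card F : ℝ) ≠ 0 := by exact_mod_cast Fintype.card_ne_zero
  have hcard : ∀ j, ((monicUnits F (j + 1)).card : ℝ) =
      (Fintype.card F : ℝ) ^ (j + 1) - (Fintype.card F : ℝ) ^ j := fun j => by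
    rw [eq_sub_iff_add_eq]
    exact_mod_cast card_monicUnits_succ j
  have h1 := pow_mul_cyclicSum (F := F) (n + 1)
  have h0 := pow_mul_cyclicSum (F := F) n
  have hsum : ∑ m ∈ range n, separableSum F m * ((monicUnits F (n + 1 - m)).card : ℝ) =
      Fintype.card F *
        ∑ m ∈ range n, separableSum F m * ((monicUnits F (n - m)).card : ℝ) := by
    rw [Finset.mul_sum]
    refine Finset.sum_congr rfl fun m hm => ?_
    obtain ⟨j, rfl⟩ := Nat.exists_eq_add_of_lt (mem_range.1 hm)
    rw [show m + j + 1 + 1 - m = j + 1 + 1 by omega, show m + j + 1 - m = j + 1 by omega,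
      hcard, hcard]
    ring
  rw [Finset.sum_range_succ, Finset.sum_range_succ, hsum, Nat.sub_self, Nat.add_sub_cancel_left,
    card_monicUnits_zero, hcard 0] at h1
  rw [Finset.sum_range_succ, Nat.sub_self, card_monicUnits_zero] at h0
  rw [eq_div_iff (pow_ne_zero _ hq)]
  push_cast at h0 h1
  linear_combination h1 - (Fintype.card F : ℝ) * h0

end PolynomialCounting

section CyclicEndomorphisms

open Polynomial Module

variable {K V W : Type*} [Field K] [AddCommGroup V] [Module K V] [FiniteDimensional K V]
  [AddCommGroup W] [Module K W] [FiniteDimensional K W]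

/-- An endomorphism whose characteristic and minimal polynomials agree has a cyclic vector. -/
lemma exists_cyclic_vector {f : End K V} (hf : f.charpoly = minpoly K f) :
    ∃ v : V, (∀ p : K[X], aeval f p v = 0 ↔ f.charpoly ∣ p) ∧
      ∀ w : V, ∃ p : K[X], p.degree < f.charpoly.degree ∧ aeval f p v = w := by
  obtain ⟨x, hx⟩ := exists_ker_toSpanSingleton_eq_annihilator K[X] (AEval' f)
  obtain ⟨v, rfl⟩ := (AEval'.of f).surjective x
  have key : ∀ p : K[X], aeval f p v = 0 ↔ f.charpoly ∣ p := fun p => by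
    rw [← span_minpoly_eq_annihilator, ← hf] at hx
    rw [← Ideal.mem_span_singleton, ← hx, LinearMap.mem_ker, LinearMap.toSpanSingleton_apply]
    rfl
  refine ⟨v, key, ?_⟩
  let φ : degreeLT K (finrank K V) →ₗ[K] V :=
    ((LinearMap.applyₗ v).comp (aeval f).toLinearMap).comp (degreeLT K (finrank K V)).subtype
  have hφ : ∀ p, φ p = aeval f (p : K[X]) v := fun _ => rfl
  have hdeg : f.charpoly.degree = finrank K V := by
    rw [degree_eq_natDegree f.charpoly_monic.ne_zero, f.charpoly_natDegree]
  have hinj : Function.Injective φ := by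
    rw [injective_iff_map_eq_zero]
    rintro ⟨p, hp⟩ h0
    rw [hφ, key] at h0
    rw [mem_degreeLT, ← hdeg] at hp
    exact Subtype.ext (eq_zero_of_dvd_of_degree_lt h0 hp)
  have hfin : finrank K (degreeLT K (finrank K V)) = finrank K V := by
    rw [(degreeLTEquiv K _).finrank_eq]; simp
  have : FiniteDimensional K (degreeLT K (finrank K V)) :=
    (degreeLTEquiv K (finrank K V)).symm.finiteDimensional
  intro w
  obtain ⟨⟨p, hp⟩, hpw⟩ :=
    (LinearMap.injective_iff_surjective_of_finrank_eq_finrank hfin).1 hinj w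
  exact ⟨p, by rwa [hdeg, ← mem_degreeLT], hpw⟩

/-- Two cyclic endomorphisms with the same characteristic polynomial are similar. -/
lemma exists_intertwining {f : End K V} {g : End K W} (hf : f.charpoly = minpoly K f)
    (hg : g.charpoly = minpoly K g) (hfg : f.charpoly = g.charpoly) :
    ∃ T : V ≃ₗ[K] W, ∀ w, T (f w) = g (T w) := by
  obtain ⟨v, hv, hv'⟩ := exists_cyclic_vector hf
  obtain ⟨u, hu, hu'⟩ := exists_cyclic_vector hg
  let φ : K[X] →ₗ[K] V := (LinearMap.applyₗ v).comp (aeval f).toLinearMap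
  let ψ : K[X] →ₗ[K] W := (LinearMap.applyₗ u).comp (aeval g).toLinearMap
  have hφ : ∀ p, φ p = aeval f p v := fun _ => rfl
  have hψ : ∀ p, ψ p = aeval g p u := fun _ => rfl
  have hφs : Function.Surjective φ := fun w => (hv' w).imp fun p hp => hp.2
  have hψs : Function.Surjective ψ := fun w => (hu' w).imp fun p hp => hp.2
  have hker : LinearMap.ker φ = LinearMap.ker ψ := by
    ext p
    rw [LinearMap.mem_ker, LinearMap.mem_ker, hφ, hψ, hv, hu, hfg]
  let T : V ≃ₗ[K] W := (φ.quotKerEquivOfSurjective hφs).symm ≪≫ₗ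
    Submodule.quotEquivOfEq _ _ hker ≪≫ₗ ψ.quotKerEquivOfSurjective hψs
  have hT : ∀ p, T (aeval f p v) = aeval g p u := fun p => by
    rw [← hφ, ← hψ]
    have : (φ.quotKerEquivOfSurjective hφs).symm (φ p) = Submodule.Quotient.mk p := by
      rw [LinearEquiv.symm_apply_eq]; rfl
    simp only [T, LinearEquiv.trans_apply, this]
    rfl
  refine ⟨T, fun w => ?_⟩
  obtain ⟨p, -, rfl⟩ := hv' w
  have h1 := hT (X * p)
  simp only [map_mul, aeval_X, Module.End.mul_apply] at h1
  rw [h1, hT]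

lemma aeval_apply_of_fixed {K V : Type*} [Field K] [AddCommGroup V] [Module K V]
    {f : End K V} {a : V} (ha : f a = a) (p : K[X]) :
    aeval f p a = p.eval 1 • a := by
  by_cases h0 : a = 0
  · simp [h0]
  · exact End.aeval_apply_of_hasEigenvector ⟨End.mem_eigenspace_iff.2 (by simpa using ha), h0⟩

/-- The fixed space of a cyclic endomorphism is at most one-dimensional. -/
lemma exists_smul_eq_of_fixed {f : End K V} (hf : f.charpoly = minpoly K f) {a b : V}
    (ha : f a = a) (hb : f b = b) (ha0 : a ≠ 0) : ∃ c : K, b = c • a := by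
  obtain ⟨v, hv, hv'⟩ := exists_cyclic_vector hf
  have hroot : f.charpoly.IsRoot 1 := by
    rw [← Module.End.hasEigenvalue_iff_isRoot_charpoly]
    exact End.hasEigenvalue_of_hasEigenvector
      ⟨End.mem_eigenspace_iff.2 (by simpa using ha), ha0⟩
  obtain ⟨h', hh'⟩ := dvd_iff_isRoot.2 hroot
  have he : f (aeval f h' v) = aeval f h' v := by
    have := (hv f.charpoly).2 dvd_rfl
    rw [hh'] at this
    simpa [sub_eq_zero, Module.End.mul_apply] using this
  have key : ∀ w, f w = w → ∃ c : K, w = c • aeval f h' v := fun w hw => by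
    obtain ⟨p, -, rfl⟩ := hv' w
    have h1 : f.charpoly ∣ (X - C 1) * p := by
      rw [← hv]
      simp [Module.End.mul_apply, hw]
    rw [hh', mul_dvd_mul_iff_left (X_sub_C_ne_zero 1)] at h1
    obtain ⟨k, rfl⟩ := h1
    refine ⟨k.eval 1, ?_⟩
    rw [mul_comm, map_mul, Module.End.mul_apply, aeval_apply_of_fixed he]
  obtain ⟨α, hα⟩ := key a ha
  obtain ⟨β, hβ⟩ := key b hb
  have hα0 : α ≠ 0 := by rintro rfl; exact ha0 (by simpa using hα)
  refine ⟨β * α⁻¹, ?_⟩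
  rw [hβ, hα, smul_smul, mul_assoc, inv_mul_cancel₀ hα0, mul_one]

/-- Only polynomials in a cyclic endomorphism commute with it. -/
lemma exists_aeval_eq_of_commute {f g : End K V} (hf : f.charpoly = minpoly K f)
    (hc : Commute f g) : ∃ p : K[X], p.degree < f.charpoly.degree ∧ aeval f p = g := by
  obtain ⟨v, -, hv'⟩ := exists_cyclic_vector hf
  obtain ⟨p, hp, hpv⟩ := hv' (g v)
  refine ⟨p, hp, ?_⟩
  ext w
  obtain ⟨r, -, rfl⟩ := hv' w
  have h1 : Commute (aeval f r) g := by
    induction r using Polynomial.induction_on' with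
    | add p q hp hq => rw [map_add]; exact hp.add_left hq
    | monomial n a =>
      rw [aeval_monomial]
      exact Commute.mul_left (Algebra.commutes a g) (hc.pow_left n)
  have h2 : Commute (aeval f r) (aeval f p) := by
    rw [Commute, SemiconjBy, ← map_mul, ← map_mul, mul_comm]
  rw [← Module.End.mul_apply, ← h2.eq, Module.End.mul_apply, hpv, ← Module.End.mul_apply, h1.eq,
    Module.End.mul_apply]

/-- Nonzero vectors of isomorphic vector spaces can be matched. -/
lemma exists_linearEquiv_apply_eq {K V W : Type*} [Field K] [AddCommGroup V] [Module K V]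
    [AddCommGroup W] [Module K W] (e : V ≃ₗ[K] W) {a : V} {b : W} (ha : a ≠ 0)
    (hb : b ≠ 0) :
    ∃ T : V ≃ₗ[K] W, T a = b := by
  have hea : e a ≠ 0 := by simpa using ha
  obtain ⟨g, hg⟩ := Submodule.exists_linearEquiv_restrict_eq
    ((LinearEquiv.toSpanNonzeroSingleton K W _ hea).symm ≪≫ₗ
      LinearEquiv.toSpanNonzeroSingleton K W _ hb)
  refine ⟨e ≪≫ₗ g, ?_⟩
  have := hg ⟨e a, Submodule.mem_span_singleton_self _⟩
  rw [LinearEquiv.trans_apply, ← this, LinearEquiv.trans_apply, LinearEquiv.coord_self]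
  simp

/-- A monic polynomial with root `1` is the characteristic and minimal polynomial of a matrix
fixing the first standard basis vector. -/
lemma exists_matrix_charpoly_eq {n : ℕ} {h : K[X]} (hh : h.Monic) (hd : h.natDegree = n + 1)
    (h1 : h.IsRoot 1) : ∃ M : Matrix (Fin (n + 1)) (Fin (n + 1)) K,
      M.charpoly = h ∧ minpoly K M = h ∧ M *ᵥ Pi.single 0 1 = Pi.single 0 1 := by
  let B := AdjoinRoot.powerBasis' hh
  have hmin : minpoly K (AdjoinRoot.root h) = h := by
    rw [AdjoinRoot.minpoly_root hh.ne_zero]; simp [hh.leadingCoeff]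
  have : Module.Finite K (AdjoinRoot h) := B.finite
  obtain ⟨h', hh'⟩ := dvd_iff_isRoot.2 h1
  have hroot : AdjoinRoot.root h * AdjoinRoot.mk h h' = AdjoinRoot.mk h h' := by
    rw [← sub_eq_zero, ← AdjoinRoot.mk_X, ← map_mul, ← map_sub, AdjoinRoot.mk_eq_zero]
    exact dvd_of_eq (by rw [hh']; simp; ring)
  have hne : AdjoinRoot.mk h h' ≠ 0 := by
    rw [Ne, AdjoinRoot.mk_eq_zero]
    intro hdvd
    have h'm : h'.Monic := (monic_X_sub_C (1 : K)).of_mul_monic_left (hh' ▸ hh)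
    have := natDegree_le_of_dvd hdvd h'm.ne_zero
    rw [hh', (monic_X_sub_C (1 : K)).natDegree_mul h'm, natDegree_X_sub_C] at this
    omega
  have hfr : B.dim = n + 1 := by simp [B, hd]
  obtain ⟨T, hT⟩ := exists_linearEquiv_apply_eq
    (B.basis.equivFun ≪≫ₗ LinearEquiv.funCongrLeft K K (finCongr hfr).symm) hne
    (b := (Pi.single 0 1 : Fin (n + 1) → K)) (by simp)
  let b := Basis.ofEquivFun T
  refine ⟨LinearMap.toMatrix b b (Algebra.lmul K _ (AdjoinRoot.root h)), ?_, ?_, ?_⟩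
  · rw [LinearMap.charpoly_toMatrix, ← LinearMap.charpoly_toMatrix _ B.basis,
      ← Algebra.leftMulMatrix_apply]
    exact (charpoly_leftMulMatrix B).trans hmin
  · rw [LinearMap.minpoly_toMatrix]
    exact (minpoly.algHom_eq _ Algebra.lmul_injective _).trans hmin
  · have hb : b 0 = AdjoinRoot.mk h h' := by
      rw [Basis.coe_ofEquivFun, LinearEquiv.symm_apply_eq, hT]
    rw [mulVec_single_one]
    ext i
    rw [col_apply, LinearMap.toMatrix_apply, hb]
    simp only [Algebra.coe_lmul_eq_mul, LinearMap.mul_apply', hroot]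
    simp [← hb, Finsupp.single_apply, Pi.single_apply, eq_comm]

end CyclicEndomorphisms

section SquarefreeCharpoly

open Polynomial

/-- Irreducible factors of the characteristic polynomial divide the minimal polynomial. -/
lemma dvd_minpoly_of_dvd_charpoly {K ι : Type*} [Field K] [Fintype ι] [DecidableEq ι]
    (M : Matrix ι ι K) {d : K[X]} (hd : Irreducible d) (h : d ∣ M.charpoly) :
    d ∣ minpoly K M := by
  have : Fact (Irreducible d) := ⟨hd⟩
  let L := AdjoinRoot d
  let N : Matrix ι ι L := M.map (algebraMap K L)
  have hroot : N.charpoly.IsRoot (AdjoinRoot.root d) := by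
    rw [charpoly_map, IsRoot, eval_map_algebraMap, AdjoinRoot.aeval_eq, AdjoinRoot.mk_eq_zero]
    exact h
  have hmin : aeval N ((minpoly K M).map (algebraMap K L)) = 0 := by
    rw [aeval_map_algebraMap]
    have := aeval_algHom_apply ((Algebra.ofId K L).mapMatrix (m := ι)) M (minpoly K M)
    rw [minpoly.aeval, map_zero] at this
    exact this
  have h2 : (minpoly L N).IsRoot (AdjoinRoot.root d) := by
    rw [← minpoly_toLin', ← Module.End.hasEigenvalue_iff_isRoot,
      Module.End.hasEigenvalue_iff_isRoot_charpoly, charpoly_toLin']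
    exact hroot
  have h3 := h2.dvd (minpoly.dvd L N hmin)
  rwa [IsRoot, eval_map_algebraMap, AdjoinRoot.aeval_eq, AdjoinRoot.mk_eq_zero] at h3

lemma charpoly_eq_minpoly_of_squarefree {K ι : Type*} [Field K] [Fintype ι] [DecidableEq ι]
    {M : Matrix ι ι K} (h : Squarefree M.charpoly) : M.charpoly = minpoly K M := by
  obtain ⟨k, hk⟩ := M.minpoly_dvd_charpoly
  have hm := minpoly.monic M.isIntegral
  have hkm : k.Monic := hm.of_mul_monic_left (hk ▸ M.charpoly_monic)
  suffices IsUnit k by rw [hk, hkm.eq_one_of_isUnit this, mul_one]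
  by_contra hu
  obtain ⟨d, hd, hdk⟩ := WfDvdMonoid.exists_irreducible_factor hu hkm.ne_zero
  have h1 : d ∣ minpoly K M := dvd_minpoly_of_dvd_charpoly M hd (hk ▸ hdk.mul_left _)
  exact hd.not_isUnit (h d (hk ▸ mul_dvd_mul h1 hdk))

end SquarefreeCharpoly

section AffineGroup

open Polynomial

variable {F : Type} [Field F] {n : ℕ}

lemma isAff_iff {x : GL (Fin (n + 1)) F} :
    IsAff x ↔ x.val *ᵥ Pi.single 0 1 = Pi.single 0 1 := by
  rw [mulVec_single_one, funext_iff]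
  constructor
  · rintro ⟨h0, h1⟩ j
    by_cases hj : j = 0
    · subst hj; simpa using h0
    · simpa [hj] using h1 j hj
  · intro h
    exact ⟨by simpa using h 0, fun j hj => by simpa [hj] using h j⟩

variable (F n) in
/-- The affine group, as the stabilizer of the first standard basis vector. -/
def affineGroup : Subgroup (GL (Fin (n + 1)) F) where
  carrier := {x | x.val *ᵥ Pi.single 0 1 = Pi.single 0 1}
  one_mem' := by rw [Set.mem_ofPred_eq, Units.val_one, one_mulVec]
  mul_mem' {x y} hx hy := by
    simp only [Set.mem_ofPred_eq] at hx hy ⊢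
    rw [Units.val_mul, ← mulVec_mulVec, hy, hx]
  inv_mem' {x} hx := by
    simp only [Set.mem_ofPred_eq] at hx ⊢
    conv_lhs => rw [← hx]
    rw [mulVec_mulVec, ← Units.val_mul, inv_mul_cancel, Units.val_one, one_mulVec]

lemma mem_affineGroup {x : GL (Fin (n + 1)) F} :
    x ∈ affineGroup F n ↔ x.val *ᵥ Pi.single 0 1 = Pi.single 0 1 := Iff.rfl

lemma toLin'_charpoly_eq_minpoly {ι : Type*} [Fintype ι] [DecidableEq ι] {M : Matrix ι ι F}
    (h : M.charpoly = minpoly F M) :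
    (toLin' M).charpoly = minpoly F (toLin' M) := by
  rw [minpoly_toLin', charpoly_toLin', h]

/-- Cyclic elements of the affine group with equal characteristic polynomials are conjugate. -/
lemma isConj_of_charpoly_eq {x y : affineGroup F n}
    (hx : x.val.val.charpoly = minpoly F x.val.val)
    (hy : y.val.val.charpoly = minpoly F y.val.val)
    (hxy : x.val.val.charpoly = y.val.val.charpoly) : IsConj x y := by
  obtain ⟨T, hT⟩ := exists_intertwining (toLin'_charpoly_eq_minpoly hx)
    (toLin'_charpoly_eq_minpoly hy) (by simpa [charpoly_toLin'] using hxy)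
  let e : Fin (n + 1) → F := Pi.single 0 1
  have he : e ≠ 0 := by simp [e]
  have hye : toLin' y.val.val e = e := y.2
  have hxe : toLin' x.val.val e = e := x.2
  have hyT : toLin' y.val.val (T e) = T e := by rw [← hT, hxe]
  obtain ⟨c, hc⟩ := exists_smul_eq_of_fixed (toLin'_charpoly_eq_minpoly hy) hye hyT he
  have hc0 : c ≠ 0 := by
    rintro rfl
    rw [zero_smul, LinearEquiv.map_eq_zero_iff] at hc
    exact he hc
  let S : (Fin (n + 1) → F) ≃ₗ[F] (Fin (n + 1) → F) :=
    T ≪≫ₗ LinearEquiv.smulOfNeZero F _ c⁻¹ (inv_ne_zero hc0)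
  have hS : ∀ w, S w = c⁻¹ • T w := fun w => rfl
  let g : GL (Fin (n + 1)) F :=
    ⟨LinearMap.toMatrix' S.toLinearMap, LinearMap.toMatrix' S.symm.toLinearMap,
      by rw [← LinearMap.toMatrix'_comp, LinearEquiv.comp_symm, LinearMap.toMatrix'_id],
      by rw [← LinearMap.toMatrix'_comp, LinearEquiv.symm_comp, LinearMap.toMatrix'_id]⟩
  have hg : g.val = LinearMap.toMatrix' S.toLinearMap := rfl
  have hgv : ∀ w, g.val *ᵥ w = S w := fun w => by
    rw [hg, ← toLin'_apply, toLin'_toMatrix']; rfl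
  have hgA : g ∈ affineGroup F n := by
    rw [mem_affineGroup, hgv, hS]
    change c⁻¹ • T e = e
    rw [hc, smul_smul, inv_mul_cancel₀ hc0, one_smul]
  rw [isConj_iff]
  refine ⟨⟨g, hgA⟩, ?_⟩
  rw [mul_inv_eq_iff_eq_mul]
  refine Subtype.ext (Units.ext (Matrix.toLin'.injective (LinearMap.ext fun w => ?_)))
  change (g.val * x.val.val) *ᵥ w = (y.val.val * g.val) *ᵥ w
  rw [← mulVec_mulVec, ← mulVec_mulVec, hgv, hgv, hS, hS, mulVec_smul]
  exact congrArg _ (hT w)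

/-- Only polynomials in a cyclic matrix commute with it. -/
lemma exists_aeval_eq_of_commute_matrix {M N : Matrix (Fin (n + 1)) (Fin (n + 1)) F}
    (hM : M.charpoly = minpoly F M) (hc : Commute M N) :
    ∃ p : F[X], p.degree < M.charpoly.degree ∧ aeval M p = N := by
  obtain ⟨p, hp, hpN⟩ := exists_aeval_eq_of_commute (toLin'_charpoly_eq_minpoly hM)
    (hc.map (toLinAlgEquiv' : _ ≃ₐ[F] _))
  refine ⟨p, by rwa [charpoly_toLin'] at hp, ?_⟩
  apply (toLinAlgEquiv' : Matrix (Fin (n + 1)) (Fin (n + 1)) F ≃ₐ[F] _).injective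
  rw [← hpN]
  exact (aeval_algHom_apply (toLinAlgEquiv' : _ ≃ₐ[F] _).toAlgHom M p).symm

lemma aeval_mulVec_of_fixed {M : Matrix (Fin (n + 1)) (Fin (n + 1)) F} {e : Fin (n + 1) → F}
    (he : M *ᵥ e = e) (p : F[X]) : aeval M p *ᵥ e = p.eval 1 • e := by
  rw [← aeval_apply_of_fixed (f := toLin' M) he p]
  have := aeval_algHom_apply
    (toLinAlgEquiv' : Matrix (Fin (n + 1)) (Fin (n + 1)) F ≃ₐ[F] _).toAlgHom M p
  exact (LinearMap.congr_fun this e).symm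

lemma isCoprime_charpoly_iff {M : Matrix (Fin (n + 1)) (Fin (n + 1)) F}
    (hM : M.charpoly = minpoly F M) (p : F[X]) :
    IsCoprime p M.charpoly ↔ IsUnit (aeval M p) := by
  constructor
  · rintro ⟨a, b, hab⟩
    have := congrArg (aeval M) hab
    rw [map_add, map_mul, map_mul, aeval_self_charpoly, mul_zero, add_zero, map_one] at this
    exact IsUnit.of_mul_eq_one_right _ this
  · rintro ⟨u, hu⟩
    have hcu : Commute M u.val := by
      rw [hu]
      simpa using (Commute.all (X : F[X]) p).map (aeval M)
    obtain ⟨r, -, hr⟩ := exists_aeval_eq_of_commute_matrix hM hcu.units_inv_right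
    have h0 : aeval M (r * p - 1) = 0 := by
      rw [map_sub, map_mul, hr, ← hu, map_one, Units.inv_mul, sub_self]
    rw [← minpoly.dvd_iff, ← hM] at h0
    obtain ⟨k, hk⟩ := h0
    exact ⟨r, -k, by linear_combination hk⟩

/-- The centralizer in the affine group of a cyclic element. -/
lemma card_centralizer [Fintype F] {x : affineGroup F n}
    (hx : x.val.val.charpoly = minpoly F x.val.val) :
    Nat.card (Subgroup.centralizer {x}) = unitCount x.val.val.charpoly := by
  classical
  have he : (Pi.single 0 1 : Fin (n + 1) → F) ≠ 0 := by simp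
  have hfix := fun p => aeval_mulVec_of_fixed (mem_affineGroup.1 x.2) p
  have hex : ∀ p : (polysLT F x.val.val.charpoly.natDegree).filter
      (fun p => IsCoprime p x.val.val.charpoly ∧ p.eval 1 = 1),
      ∃ z : Subgroup.centralizer {x}, z.val.val.val = aeval x.val.val p.val := by
    rintro ⟨p, hp⟩
    rw [Finset.mem_filter, isCoprime_charpoly_iff hx] at hp
    obtain ⟨-, ⟨u, hu⟩, h1⟩ := hp
    have huA : u ∈ affineGroup F n := by
      rw [mem_affineGroup, hu, hfix, h1, one_smul]
    refine ⟨⟨⟨u, huA⟩, ?_⟩, hu⟩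
    rw [Subgroup.mem_centralizer_singleton_iff]
    refine Subtype.ext (Units.ext ?_)
    change u.val * x.val.val = x.val.val * u.val
    rw [hu]
    simpa using ((Commute.all p (X : F[X])).map (aeval x.val.val)).eq
  choose φ hφ using hex
  rw [unitCount, ← Nat.card_eq_finsetCard]
  symm
  refine Nat.card_congr (Equiv.ofBijective φ ⟨?_, ?_⟩)
  · rintro ⟨p, hp⟩ ⟨r, hr⟩ h
    have h0 : aeval x.val.val (p - r) = 0 := by
      rw [map_sub, sub_eq_zero, ← hφ ⟨p, hp⟩, ← hφ ⟨r, hr⟩, h]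
    rw [← minpoly.dvd_iff, ← hx] at h0
    rw [Finset.mem_filter, degree_lt_natDegree_iff (charpoly_monic _)] at hp hr
    refine Subtype.ext (sub_eq_zero.1 (eq_zero_of_dvd_of_degree_lt h0 ?_))
    exact (degree_sub_le _ _).trans_lt (max_lt hp.1 hr.1)
  · intro z
    have hz : Commute x.val.val z.val.val.val :=
      (congrArg (fun w : affineGroup F n => w.val.val)
        (Subgroup.mem_centralizer_singleton_iff.1 z.2)).symm
    obtain ⟨p, hp, hpz⟩ := exists_aeval_eq_of_commute_matrix hx hz
    have hp1 : p.eval 1 = 1 := by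
      have h := hfix p
      rw [hpz, mem_affineGroup.1 z.val.2] at h
      simpa using (congrFun h 0).symm
    refine ⟨⟨p, ?_⟩, Subtype.ext (Subtype.ext (Units.ext ?_))⟩
    · rw [Finset.mem_filter, degree_lt_natDegree_iff (charpoly_monic _),
        isCoprime_charpoly_iff hx, hpz]
      exact ⟨hp, z.val.val.isUnit, hp1⟩
    · rw [hφ, hpz]

lemma card_conjClass_mul_card_centralizer {G : Type*} [Group G] [Finite G] (x : G) :
    Nat.card {y : G // IsConj x y} * Nat.card (Subgroup.centralizer {x}) = Nat.card G := by
  rw [Subgroup.nat_card_centralizer_nat_card_stabilizer,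
    Nat.card_congr (ConjAct.toConjAct (G := G)).toEquiv,
    ← Subgroup.index_mul_card (MulAction.stabilizer (ConjAct G) x), MulAction.index_stabilizer,
    ConjAct.orbit_eq_carrier_conjClasses]
  congr 1

/-- The number of cyclic affine elements with a given characteristic polynomial. -/
lemma card_cyclic_charpoly_eq [Fintype F] {f : F[X]} (hf : f ∈ monicUnits F n) :
    Nat.card {x : affineGroup F n // x.val.val.charpoly = minpoly F x.val.val ∧
      x.val.val.charpoly = (X - C 1) * f} * unitCount ((X - C 1) * f) =
      Nat.card (affineGroup F n) := by
  rw [mem_monicUnits] at hf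
  obtain ⟨hm, hn, h0⟩ := hf
  have hM := (monic_X_sub_C (1 : F)).mul hm
  obtain ⟨M, hM1, hM2, hM3⟩ := exists_matrix_charpoly_eq hM
    (by rw [(monic_X_sub_C (1 : F)).natDegree_mul hm, natDegree_X_sub_C, hn, add_comm])
    (by simp : ((X - C 1) * f).IsRoot 1)
  have hdet : IsUnit M := by
    rw [Matrix.isUnit_iff_isUnit_det, isUnit_iff_ne_zero, det_eq_sign_charpoly_coeff, hM1,
      coeff_zero_eq_eval_zero]
    simp [h0]
  obtain ⟨u, rfl⟩ := hdet
  let x : affineGroup F n := ⟨u, hM3⟩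
  have hx : x.val.val.charpoly = minpoly F x.val.val := hM1.trans hM2.symm
  rw [← card_conjClass_mul_card_centralizer x, card_centralizer hx, ← hM1]
  congr 1
  refine Nat.card_congr (Equiv.subtypeEquivRight fun y => ?_)
  constructor
  · rintro ⟨hy, hy'⟩
    exact isConj_of_charpoly_eq hx hy hy'.symm
  · intro h
    obtain ⟨c, rfl⟩ := isConj_iff.1 h
    have hval : (c * x * c⁻¹).val.val = c.val.val * u.val * (c.val⁻¹).val := rfl
    rw [hval, coe_units_inv, charpoly_units_conj]
    refine ⟨hx.trans ?_, rfl⟩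
    rw [← coe_units_inv]
    exact (minpoly.algEquiv_eq (MulSemiringAction.toAlgEquiv F
      (Matrix (Fin (n + 1)) (Fin (n + 1)) F) (ConjAct.toConjAct c.val)) u.val).symm

lemma exists_charpoly_eq [Fintype F] (x : affineGroup F n) :
    ∃ f ∈ monicUnits F n, x.val.val.charpoly = (X - C 1) * f := by
  have hroot : x.val.val.charpoly.IsRoot 1 := by
    rw [← charpoly_toLin', ← Module.End.hasEigenvalue_iff_isRoot_charpoly]
    refine Module.End.hasEigenvalue_of_hasEigenvector (x := Pi.single 0 1)
      ⟨Module.End.mem_eigenspace_iff.2 ?_, by simp⟩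
    rw [toLin'_apply, mem_affineGroup.1 x.2, one_smul]
  obtain ⟨f, hf⟩ := dvd_iff_isRoot.2 hroot
  have hm : f.Monic := (monic_X_sub_C (1 : F)).of_mul_monic_left (hf ▸ charpoly_monic _)
  refine ⟨f, mem_monicUnits.2 ⟨hm, ?_, ?_⟩, hf⟩
  · have := charpoly_natDegree_eq_dim x.val.val
    rw [hf, (monic_X_sub_C (1 : F)).natDegree_mul hm, natDegree_X_sub_C, Fintype.card_fin] at this
    omega
  · intro h0
    have hu : x.val.val.det ≠ 0 := (x.val.val.isUnit_iff_isUnit_det.1 x.val.isUnit).ne_zero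
    apply hu
    rw [det_eq_sign_charpoly_coeff, hf, coeff_zero_eq_eval_zero]
    simp [h0]

open scoped Classical in
lemma card_cyclic_div [Fintype F] (P : F[X] → Prop) :
    (Nat.card {x : GL (Fin (n + 1)) F // IsAff x ∧ x.val.charpoly = minpoly F x.val ∧
      P x.val.charpoly} : ℝ) / (Nat.card {x : GL (Fin (n + 1)) F // IsAff x} : ℝ) =
      ∑ f ∈ (monicUnits F n).filter (fun f => P ((X - C 1) * f)),
        (unitCount ((X - C 1) * f) : ℝ)⁻¹ := by
  have hA : Nat.card {x : GL (Fin (n + 1)) F // IsAff x} = Nat.card (affineGroup F n) :=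
    Nat.card_congr (Equiv.subtypeEquivRight fun x => isAff_iff)
  have hA0 : (Nat.card (affineGroup F n) : ℝ) ≠ 0 := by exact_mod_cast Nat.card_pos.ne'
  have hfib : Nat.card {x : GL (Fin (n + 1)) F // IsAff x ∧ x.val.charpoly = minpoly F x.val ∧
      P x.val.charpoly} = ∑ f ∈ (monicUnits F n).filter (fun f => P ((X - C 1) * f)),
      Nat.card {x : affineGroup F n // x.val.val.charpoly = minpoly F x.val.val ∧
        x.val.val.charpoly = (X - C 1) * f} := by
    have h1 : Nat.card {x : GL (Fin (n + 1)) F // IsAff x ∧ x.val.charpoly = minpoly F x.val ∧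
        P x.val.charpoly} = ((Finset.univ : Finset (affineGroup F n)).filter fun x =>
          x.val.val.charpoly = minpoly F x.val.val ∧ P x.val.val.charpoly).card := by
      rw [← Fintype.card_subtype, ← Nat.card_eq_fintype_card]
      refine Nat.card_congr ⟨fun x => ⟨⟨x.1, isAff_iff.1 x.2.1⟩, x.2.2⟩,
        fun x => ⟨x.1.1, isAff_iff.2 x.1.2, x.2⟩, fun _ => rfl, fun _ => rfl⟩
    have hdiv : ∀ f : F[X], ((X - C 1) * f) /ₘ (X - C 1) = f := fun f =>
      mul_divByMonic_cancel_left f (monic_X_sub_C 1)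
    rw [h1, Finset.card_eq_sum_card_fiberwise (f := fun x => x.val.val.charpoly /ₘ (X - C 1))
      (t := (monicUnits F n).filter (fun f => P ((X - C 1) * f)))]
    · refine Finset.sum_congr rfl fun f hf => ?_
      rw [Finset.filter_filter, ← Fintype.card_subtype, ← Nat.card_eq_fintype_card]
      refine Nat.card_congr (Equiv.subtypeEquivRight fun x => ?_)
      constructor
      · rintro ⟨⟨hx, -⟩, hxf⟩
        obtain ⟨g, -, hg⟩ := exists_charpoly_eq x
        rw [hg, hdiv] at hxf
        exact ⟨hx, hxf ▸ hg⟩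
      · rintro ⟨hx, hxf⟩
        exact ⟨⟨hx, hxf ▸ (Finset.mem_filter.1 hf).2⟩, by rw [hxf, hdiv]⟩
    · intro x hx
      obtain ⟨g, hgm, hg⟩ := exists_charpoly_eq x
      have hP := (Finset.mem_filter.1 (Finset.mem_coe.1 hx)).2.2
      beta_reduce
      rw [Finset.mem_coe, Finset.mem_filter, hg, hdiv]
      exact ⟨hgm, hg ▸ hP⟩
  rw [hA, hfib]
  push_cast
  rw [Finset.sum_div]
  refine Finset.sum_congr rfl fun f hf => ?_
  rw [Finset.mem_filter] at hf
  have h := card_cyclic_charpoly_eq hf.1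
  have hpos : (unitCount ((X - C 1) * f) : ℝ) ≠ 0 := by
    exact_mod_cast (unitCount_pos ((monic_X_sub_C (1 : F)).mul (mem_monicUnits.1 hf.1).1)
      (by simp)).ne'
  rw [div_eq_iff hA0, ← h]
  push_cast
  field_simp

end AffineGroup

/-- For `n ≥ 1`, `c_A(n,q) - c_A(n-1,q) = (s_A(n,q) - s_A(n-1,q))/q^n`; this is the
coefficientwise form of `(1-u) C_A(u,q) = (1-u/q) S_A(u/q,q)`. -/
theorem affine_cyclic_separable_relation (F : Type) [Field F] [Fintype F] (q : ℕ)
    (hq : q = Fintype.card F) (n : ℕ) (hn : 1 ≤ n) :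
    cA F n - cA F (n - 1) = (sA F n - sA F (n - 1)) / (q : ℝ) ^ n := by
  classical
  have hc : ∀ m, cA F m = cyclicSum F m := fun m => by
    simpa [cyclicSum, cA] using card_cyclic_div (F := F) (n := m) fun _ => True
  have hs : ∀ m, sA F m = separableSum F m := fun m => by
    rw [separableSum, ← card_cyclic_div (F := F) (n := m) Squarefree, sA]
    congr 2
    refine Nat.card_congr (Equiv.subtypeEquivRight fun x => and_congr_right fun _ => ?_)
    exact ⟨fun h => ⟨charpoly_eq_minpoly_of_squarefree h, h⟩, fun h => h.2⟩
  obtain ⟨m, rfl⟩ := Nat.exists_eq_add_of_le' hn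
  rw [Nat.add_sub_cancel, hc, hc, hs, hs, hq]
  exact cyclicSum_sub m
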